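/- arXiv:1601.05747 — 3 statements merged into one kernel-verified Lean document; each statement's English description precedes it below -/
import Mathlib

section
/- Let V be a finite type and r a relation on V that is acyclic (there is no a with TransGen r a a). Define the reduced relation r' by: r' a b if and only if r a b and there is no c ∈ V with TransGen r a c and TransGen r c b. Then the transitive closures coincide: Relation.TransGen r' = Relation.TransGen r. -/
/-- The transitive reduction of an acyclic relation on a finite type has the same
transitive closure as the original relation. -/
theorem transGen_transitiveReduction_eq {V : Type*} [Finite V] (r : V → V → Prop)
    (hacyc : ¬ ∃ a : V, Relation.TransGen r a a) :
    Relation.TransGen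
        (fun a b => r a b ∧
          ¬ ∃ c : V, Relation.TransGen r a c ∧ Relation.TransGen r c b)
      = Relation.TransGen r := by
  have key : ∀ n : ℕ, ∀ a b : V, Relation.TransGen r a b →
      Set.ncard {c | Relation.TransGen r a c ∧ Relation.TransGen r c b} = n →
      Relation.TransGen (fun a b => r a b ∧
          ¬ ∃ c : V, Relation.TransGen r a c ∧ Relation.TransGen r c b) a b := by
    intro n
    induction n using Nat.strong_induction_on with
    | _ n ih =>
      intro a b hab hn
      by_cases h : ∃ c : V, Relation.TransGen r a c ∧ Relation.TransGen r c b
      · obtain ⟨c, hac, hcb⟩ := h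
        refine Relation.TransGen.trans (ih _ ?_ a c hac rfl) (ih _ ?_ c b hcb rfl)
        · rw [← hn]
          apply Set.ncard_lt_ncard _ (Set.toFinite _)
          refine ⟨fun d hd => ⟨hd.1, hd.2.trans hcb⟩, fun hs => ?_⟩
          exact hacyc ⟨c, (hs ⟨hac, hcb⟩ : _ ∧ _).2⟩
        · rw [← hn]
          apply Set.ncard_lt_ncard _ (Set.toFinite _)
          refine ⟨fun d hd => ⟨hac.trans hd.1, hd.2⟩, fun hs => ?_⟩
          exact hacyc ⟨c, (hs ⟨hac, hcb⟩ : _ ∧ _).1⟩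
      · refine Relation.TransGen.single ⟨?_, h⟩
        cases hab with
        | single h1 => exact h1
        | tail h1 h2 => exact absurd ⟨_, h1, Relation.TransGen.single h2⟩ h
  funext a b
  apply propext
  exact ⟨fun h => Relation.TransGen.mono (fun _ _ h => h.1) a b h, fun h => key _ a b h rfl⟩
end

section
/- Let u and v be unit vectors in the Euclidean plane EuclideanSpace ℝ (Fin 2) with ⟪u, v⟫ = cos θ for some θ ∈ (0, π), and let a, b > 0 be real numbers. Then the point p = (b/sin θ)·u + (a/sin θ)·v is the unique point of the open cone {s·u + t·v : s > 0, t > 0} whose distance to the line ℝ∙u (the real span of u) equals a and whose distance to the line ℝ∙v equals b, distances being Metric.infDist to the corresponding submodules. -/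
open RealInnerProductSpace

theorem le_of_sq_le_sq_aux {x y : ℝ} (hy : 0 ≤ y) (h : x ^ 2 ≤ y ^ 2) : x ≤ y :=
  abs_le_of_sq_le_sq' h hy |>.2

theorem infDist_aux (θ : ℝ) (hθ : θ ∈ Set.Ioo 0 Real.pi)
    (u v : EuclideanSpace ℝ (Fin 2)) (hu : ‖u‖ = 1) (hv : ‖v‖ = 1)
    (huv : ⟪u, v⟫ = Real.cos θ) (s t : ℝ) (ht : 0 < t) :
    Metric.infDist (s • u + t • v)
      ((ℝ ∙ u : Submodule ℝ (EuclideanSpace ℝ (Fin 2))) : Set (EuclideanSpace ℝ (Fin 2)))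
      = t * Real.sin θ := by
  have hs : 0 < Real.sin θ := Real.sin_pos_of_mem_Ioo hθ
  have h1 := Real.sin_sq_add_cos_sq θ
  have key : ∀ c : ℝ, dist (s • u + t • v) (c • u) ^ 2
      = (s - c + t * Real.cos θ) ^ 2 + (t * Real.sin θ) ^ 2 := by
    intro c
    have e : s • u + t • v - c • u = (s - c) • u + t • v := by module
    rw [dist_eq_norm, e, norm_add_sq_real, norm_smul, norm_smul, inner_smul_left,
      inner_smul_right, huv, hu, hv]
    simp only [Real.norm_eq_abs, mul_one, sq_abs, conj_trivial]
    linear_combination (-t ^ 2) * h1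
  apply le_antisymm
  · refine (Metric.infDist_le_dist_of_mem
      (y := (s + t * Real.cos θ) • u) (Submodule.mem_span_singleton.2 ⟨_, rfl⟩)).trans ?_
    refine le_of_sq_le_sq_aux (by positivity) ?_
    rw [key]
    apply le_of_eq
    ring
  · rw [Metric.le_infDist ⟨0, Submodule.zero_mem _⟩]
    intro y hy
    obtain ⟨c, rfl⟩ := Submodule.mem_span_singleton.1 hy
    refine le_of_sq_le_sq_aux dist_nonneg ?_
    rw [key]
    nlinarith [sq_nonneg (s - c + t * Real.cos θ)]

/-- The point `(b / sin θ) • u + (a / sin θ) • v` is the unique point of the open cone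
`{s • u + t • v : s > 0, t > 0}` lying at distance `a` from the line `ℝ ∙ u` and at
distance `b` from the line `ℝ ∙ v`. -/
theorem vertexPolygon_point_unique (θ : ℝ) (hθ : θ ∈ Set.Ioo 0 Real.pi)
    (a b : ℝ) (ha : 0 < a) (hb : 0 < b)
    (u v : EuclideanSpace ℝ (Fin 2)) (hu : ‖u‖ = 1) (hv : ‖v‖ = 1)
    (huv : ⟪u, v⟫ = Real.cos θ) :
    ∀ p : EuclideanSpace ℝ (Fin 2),
      ((∃ s t : ℝ, 0 < s ∧ 0 < t ∧ p = s • u + t • v) ∧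
        Metric.infDist p
          ((ℝ ∙ u : Submodule ℝ (EuclideanSpace ℝ (Fin 2))) : Set (EuclideanSpace ℝ (Fin 2)))
          = a ∧
        Metric.infDist p
          ((ℝ ∙ v : Submodule ℝ (EuclideanSpace ℝ (Fin 2))) : Set (EuclideanSpace ℝ (Fin 2)))
          = b) ↔
      p = (b / Real.sin θ) • u + (a / Real.sin θ) • v := by
  have hs : 0 < Real.sin θ := Real.sin_pos_of_mem_Ioo hθ
  have hvu : ⟪v, u⟫ = Real.cos θ := by rw [real_inner_comm]; exact huv
  intro p
  constructor
  · rintro ⟨⟨s, t, hs0, ht0, rfl⟩, h1, h2⟩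
    rw [infDist_aux θ hθ u v hu hv huv s t ht0] at h1
    rw [add_comm, infDist_aux θ hθ v u hv hu hvu t s hs0] at h2
    rw [← h1, ← h2, mul_div_cancel_right₀ _ hs.ne', mul_div_cancel_right₀ _ hs.ne']
  · rintro rfl
    have hA : 0 < a / Real.sin θ := by positivity
    have hB : 0 < b / Real.sin θ := by positivity
    refine ⟨⟨_, _, hB, hA, rfl⟩, ?_, ?_⟩
    · rw [infDist_aux θ hθ u v hu hv huv _ _ hA, div_mul_cancel₀ _ hs.ne']
    · rw [add_comm, infDist_aux θ hθ v u hv hu hvu _ _ hB, div_mul_cancel₀ _ hs.ne']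
end

section
/- Let u and v be unit vectors in the Euclidean plane EuclideanSpace ℝ (Fin 2) with angle u v = θ for some θ ∈ (0, π), and let s, t > 0 be real numbers. Then for p = s·u + t·v, the unsigned angles satisfy angle u p + angle p v = θ, where angle denotes InnerProductGeometry.angle. -/
open InnerProductGeometry

/-- If `u, v` are unit vectors in the plane making angle `θ ∈ (0, π)` and `p = s • u + t • v`
with `s, t > 0`, then the unsigned angles satisfy `angle u p + angle p v = θ`. -/
theorem angle_add_angle_of_mem_openCone (θ : ℝ) (hθ : θ ∈ Set.Ioo 0 Real.pi)
    (u v : EuclideanSpace ℝ (Fin 2)) (hu : ‖u‖ = 1) (hv : ‖v‖ = 1)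
    (huv : angle u v = θ) (s t : ℝ) (hs : 0 < s) (ht : 0 < t) :
    angle u (s • u + t • v) + angle (s • u + t • v) v = θ := by
  have hv0 : v ≠ 0 := by
    rintro rfl
    simp at hv
  have h := angle_eq_angle_add_add_angle_add (s • u) (smul_ne_zero ht.ne' hv0)
  rw [angle_smul_left_of_pos _ _ hs, angle_smul_right_of_pos _ _ ht,
    angle_smul_left_of_pos _ _ hs, angle_smul_left_of_pos _ _ ht] at h
  rw [angle_comm (s • u + t • v) v, ← h, huv]
end
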